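/- Let X be a normed vector space over ℝ or ℂ and T : X → X a bounded linear operator. Then the chain recurrent set CR(T) is a closed linear subspace of X which is invariant under T, i.e., T(CR(T)) ⊆ CR(T). -/

import Mathlib

/-- An `ε`-chain of `T` from `x` to `y`: a finite sequence `x = c 0, c 1, …, c n = y`
with `n ≥ 1` such that `‖T (c i) - c (i+1)‖ < ε` for every `0 ≤ i < n`. -/
def EpsChain {E : Type*} [NormedAddCommGroup E] (T : E → E) (ε : ℝ) (x y : E) : Prop :=
  ∃ (n : ℕ) (c : ℕ → E), 1 ≤ n ∧ c 0 = x ∧ c n = y ∧ ∀ i < n, ‖T (c i) - c (i + 1)‖ < ε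

/-- `x` is a chain recurrent point of `T` if for every `ε > 0` there is an `ε`-chain
beginning and ending at `x`. -/
def ChainRecurrent {E : Type*} [NormedAddCommGroup E] (T : E → E) (x : E) : Prop :=
  ∀ ε > 0, EpsChain T ε x x

theorem EpsChain.exists_periodic {E : Type*} [NormedAddCommGroup E] {T : E → E} {ε : ℝ} {x : E}
    (h : EpsChain T ε x x) :
    ∃ (n : ℕ) (c : ℕ → E), 1 ≤ n ∧ c 0 = x ∧ Function.Periodic c n ∧
      ∀ i, ‖T (c i) - c (i + 1)‖ < ε := by
  obtain ⟨n, c, hn, h0, h1, hc⟩ := h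
  refine ⟨n, fun i => c (i % n), hn, by simpa using h0, fun i => by simp, fun i => ?_⟩
  have hi : i % n < n := Nat.mod_lt _ hn
  have key : c ((i + 1) % n) = c (i % n + 1) := by
    rw [← Nat.mod_add_mod]
    rcases Nat.lt_or_ge (i % n + 1) n with h | h
    · rw [Nat.mod_eq_of_lt h]
    · have h' : i % n + 1 = n := by omega
      rw [h', Nat.mod_self, h0, h1]
  simpa only [key] using hc _ hi

theorem EpsChain.of_periodic {E : Type*} [NormedAddCommGroup E] {T : E → E} {ε : ℝ}
    {n : ℕ} {c : ℕ → E} (hn : 1 ≤ n) (hp : Function.Periodic c n)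
    (hc : ∀ i, ‖T (c i) - c (i + 1)‖ < ε) : EpsChain T ε (c 0) (c 0) :=
  ⟨n, c, hn, rfl, by simpa using hp 0, fun i _ => hc i⟩

section

variable {𝕜 : Type*} [RCLike 𝕜] {X : Type*} [NormedAddCommGroup X] [NormedSpace 𝕜 X]
  (T : X →L[𝕜] X)

theorem ChainRecurrent.zero : ChainRecurrent T 0 := fun ε hε =>
  ⟨1, fun _ => 0, le_rfl, rfl, rfl, fun _ _ => by simpa using hε⟩

variable {T}

theorem ChainRecurrent.add {x y : X} (hx : ChainRecurrent T x) (hy : ChainRecurrent T y) :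
    ChainRecurrent T (x + y) := by
  intro ε hε
  obtain ⟨n, c, hn, rfl, hcp, hc⟩ := (hx (ε / 2) (half_pos hε)).exists_periodic
  obtain ⟨m, d, hm, rfl, hdp, hd⟩ := (hy (ε / 2) (half_pos hε)).exists_periodic
  refine EpsChain.of_periodic (n := m * n) (c := c + d) (Nat.mul_pos hm hn) ?_ fun i => ?_
  · refine (by simpa using hcp.nat_mul m : Function.Periodic c (m * n)).add ?_
    simpa [mul_comm m n] using hdp.nat_mul n
  · calc ‖T (c i + d i) - (c (i + 1) + d (i + 1))‖
        = ‖(T (c i) - c (i + 1)) + (T (d i) - d (i + 1))‖ := by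
          rw [map_add, add_sub_add_comm]
      _ ≤ ‖T (c i) - c (i + 1)‖ + ‖T (d i) - d (i + 1)‖ := norm_add_le _ _
      _ < ε := by linarith [hc i, hd i]

/-- Bounded operators commuting with `T` preserve chain recurrence. -/
theorem ChainRecurrent.map_of_commute {S : X →L[𝕜] X} (hS : Commute S T) {x : X}
    (hx : ChainRecurrent T x) : ChainRecurrent T (S x) := by
  intro ε hε
  have hpos : 0 < ‖S‖ + 1 := by positivity
  obtain ⟨n, c, hn, h0, h1, hc⟩ := hx (ε / (‖S‖ + 1)) (div_pos hε hpos)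
  refine ⟨n, fun i => S (c i), hn, congrArg S h0, congrArg S h1, fun i hi => ?_⟩
  have hST : T (S (c i)) = S (T (c i)) := (DFunLike.congr_fun hS.eq (c i)).symm
  calc ‖T (S (c i)) - S (c (i + 1))‖
      = ‖S (T (c i) - c (i + 1))‖ := by rw [hST, map_sub]
    _ ≤ ‖S‖ * ‖T (c i) - c (i + 1)‖ := S.le_opNorm _
    _ ≤ (‖S‖ + 1) * ‖T (c i) - c (i + 1)‖ := by gcongr; linarith
    _ < ε := by rw [mul_comm]; exact (lt_div_iff₀ hpos).1 (hc i hi)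

variable (T) in
theorem isClosed_setOf_chainRecurrent : IsClosed {x | ChainRecurrent T x} := by
  refine isClosed_of_closure_subset fun x hx ε hε => ?_
  have hpos : 0 < ‖T‖ + 1 := by positivity
  obtain ⟨y, hy, hxy⟩ := Metric.mem_closure_iff.1 hx (ε / 2 / (‖T‖ + 1)) (by positivity)
  obtain ⟨n, c, hn, rfl, hcp, hc⟩ := (hy (ε / 2) (half_pos hε)).exists_periodic
  let d : ℕ → X := fun i => if n ∣ i then x - c 0 else 0
  have hd : ∀ i, ‖d i‖ ≤ ‖x - c 0‖ := fun i => by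
    by_cases h : n ∣ i <;> simp [d, h]
  have hdp : Function.Periodic d n := fun i => by simp [d]
  have hx0 : (c + d) 0 = x := by simp [d]
  rw [← hx0]
  refine EpsChain.of_periodic hn (hcp.add hdp) fun i => ?_
  rw [dist_eq_norm, lt_div_iff₀ hpos] at hxy
  have hT : ‖T (d i)‖ ≤ ‖T‖ * ‖x - c 0‖ := T.le_opNorm_of_le (hd i)
  calc ‖T (c i + d i) - (c (i + 1) + d (i + 1))‖
      = ‖(T (c i) - c (i + 1)) + (T (d i) - d (i + 1))‖ := by
        rw [map_add, add_sub_add_comm]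
    _ ≤ ‖T (c i) - c (i + 1)‖ + (‖T (d i)‖ + ‖d (i + 1)‖) :=
        (norm_add_le _ _).trans (add_le_add_right (norm_sub_le _ _) _)
    _ < ε := by linarith [hc i, hd (i + 1)]

end

theorem stmt_2 {𝕜 : Type*} [RCLike 𝕜] {X : Type*} [NormedAddCommGroup X] [NormedSpace 𝕜 X]
    (T : X →L[𝕜] X) :
    (∃ S : Submodule 𝕜 X, (S : Set X) = {x | ChainRecurrent (⇑T) x}) ∧
    IsClosed {x | ChainRecurrent (⇑T) x} ∧
    (∀ x, ChainRecurrent (⇑T) x → ChainRecurrent (⇑T) (T x)) := by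
  refine ⟨⟨⟨⟨⟨{x | ChainRecurrent T x}, fun hx hy => ChainRecurrent.add hx hy⟩,
    ChainRecurrent.zero T⟩, fun a x hx => ?_⟩, rfl⟩, isClosed_setOf_chainRecurrent T,
    fun x hx => hx.map_of_commute (Commute.refl T)⟩
  exact ChainRecurrent.map_of_commute (S := a • ContinuousLinearMap.id 𝕜 X)
    ((Commute.one_left T).smul_left a) hx
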